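/- For every m > 0 and every x ∈ ℝ, and every Schwartz function φ on ℝ with φ̂ supported in [0,∞), one has √m · ‖|D|^{(m−1)/2} e^{it|D|^m} φ(x)‖_{L²(ℝ_t)} = ‖φ(x + ·)‖_{L²(ℝ)} = ‖φ‖_{L²(ℝ)}. -/

import Mathlib

open MeasureTheory FourierTransform SchwartzMap
open scoped ContDiff

/-- The Fourier integral of a function in `L¹ ∩ L²` represents its `L²` Fourier transform. -/
theorem fourierIntegral_ae_eq_Lp_fourier {f : ℝ → ℂ} (hf1 : Integrable f) (hf2 : MemLp f 2) :
    𝓕 f =ᵐ[volume] (𝓕 (hf2.toLp f) : Lp ℂ 2 (volume : Measure ℝ)) := by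
  have hcont : Continuous (𝓕 f) :=
    VectorFourier.fourierIntegral_continuous Real.continuous_fourierChar
      (innerSL ℝ).continuous₂ hf1
  refine ae_eq_of_integral_contDiff_smul_eq hcont.locallyIntegrable
    ((Lp.memLp _).locallyIntegrable one_le_two) fun g g_smooth g_cpt => ?_
  have hg₁ : HasCompactSupport (Complex.ofRealCLM ∘ g) := g_cpt.comp_left rfl
  have hg₂ : ContDiff ℝ ∞ (Complex.ofRealCLM ∘ g) := by fun_prop
  let u : 𝓢(ℝ, ℂ) := hg₁.toSchwartzMap hg₂
  have hu : ∀ x, u x = (g x : ℂ) := fun x => rfl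
  have h := congrArg (fun T => T u) (Lp.fourier_toTemperedDistribution_eq (hf2.toLp f))
  simp only [TemperedDistribution.fourier_apply, Lp.toTemperedDistribution_apply] at h
  have h3 : ∫ x, u x • 𝓕 f x = ∫ x, 𝓕 u x • f x := by
    have := VectorFourier.integral_fourierIntegral_smul_eq_flip (μ := (volume : Measure ℝ))
      (ν := (volume : Measure ℝ)) (L := innerₗ ℝ) (f := u) (g := f)
      Real.continuous_fourierChar (innerSL ℝ).continuous₂ u.integrable hf1
    rw [flip_innerₗ] at this
    exact this.symm
  have h4 : ∫ x, 𝓕 u x • (hf2.toLp f) x = ∫ x, 𝓕 u x • f x :=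
    integral_congr_ae (hf2.coeFn_toLp.mono fun x hx => by simp only [hx])
  simp only [Complex.real_smul, smul_eq_mul, hu] at *
  rw [h3, ← h4, h]

theorem memLp_fourierIntegral {f : ℝ → ℂ} (hf1 : Integrable f) (hf2 : MemLp f 2) :
    MemLp (𝓕 f) 2 :=
  (memLp_congr_ae (fourierIntegral_ae_eq_Lp_fourier hf1 hf2)).2 (Lp.memLp _)

/-- Plancherel's theorem for the Fourier integral on `L¹ ∩ L²`. -/
theorem eLpNorm_fourierIntegral {f : ℝ → ℂ} (hf1 : Integrable f) (hf2 : MemLp f 2) :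
    eLpNorm (𝓕 f) 2 volume = eLpNorm f 2 volume := by
  rw [eLpNorm_congr_ae (fourierIntegral_ae_eq_Lp_fourier hf1 hf2), ← Lp.enorm_def,
    ← ofReal_norm, Lp.norm_fourier_eq, ofReal_norm, Lp.enorm_toLp]

theorem eLpNorm_two_eq_sqrt_integral {f : ℝ → ℂ} (hf : MemLp f 2) :
    eLpNorm f 2 volume = ENNReal.ofReal (√(∫ x, ‖f x‖ ^ 2)) := by
  rw [hf.eLpNorm_eq_integral_rpow_norm two_ne_zero ENNReal.ofNat_ne_top, Real.sqrt_eq_rpow]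
  norm_num

theorem integral_norm_sq_fourierIntegral {f : ℝ → ℂ} (hf1 : Integrable f) (hf2 : MemLp f 2) :
    ∫ x, ‖𝓕 f x‖ ^ 2 = ∫ x, ‖f x‖ ^ 2 := by
  have h := eLpNorm_fourierIntegral hf1 hf2
  rw [eLpNorm_two_eq_sqrt_integral hf2, eLpNorm_two_eq_sqrt_integral
    (memLp_fourierIntegral hf1 hf2), ENNReal.ofReal_eq_ofReal_iff (by positivity) (by positivity),
    Real.sqrt_inj (by positivity) (by positivity)] at h
  exact h

/-- The Fourier transform of a Schwartz function in the angular-frequency normalization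
`ξ ↦ ∫ e^{-iξy} φ(y) dy`. -/
theorem exists_schwartzMap_angular_fourier (φ : 𝓢(ℝ, ℂ)) :
    ∃ Φ : 𝓢(ℝ, ℂ),
      (∀ ξ, Φ ξ = ∫ y : ℝ, Complex.exp (-Complex.I * ((ξ * y : ℝ) : ℂ)) * φ y) ∧
      ∫ ξ, ‖Φ ξ‖ ^ 2 = 2 * Real.pi * ∫ y, ‖φ y‖ ^ 2 := by
  have hc : (2 * Real.pi)⁻¹ ≠ 0 := by positivity
  have hΦ : ∀ ξ, compCLMOfContinuousLinearEquiv ℂ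
      (ContinuousLinearEquiv.unitsEquivAut ℝ (Units.mk0 _ hc)) (𝓕 φ) ξ
        = 𝓕 φ ((2 * Real.pi)⁻¹ * ξ) := fun ξ => by
    simp [mul_comm]
  refine ⟨compCLMOfContinuousLinearEquiv ℂ
    (ContinuousLinearEquiv.unitsEquivAut ℝ (Units.mk0 _ hc)) (𝓕 φ), fun ξ => ?_, ?_⟩
  · rw [hΦ, fourier_coe, Real.fourier_eq']
    refine integral_congr_ae (.of_forall fun y => ?_)
    simp only [smul_eq_mul]
    congr 2
    have : (Real.pi : ℂ) ≠ 0 := by exact_mod_cast Real.pi_ne_zero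
    simp
    field_simp
  · simp only [hΦ]
    rw [Measure.integral_comp_mul_left (fun ξ => ‖𝓕 φ ξ‖ ^ 2), integral_norm_sq_fourier,
      inv_inv, abs_of_pos (by positivity), smul_eq_mul]

theorem SchwartzMap.integrableOn_rpow_smul (Φ : 𝓢(ℝ, ℂ)) {s : ℝ} (hs : -1 < s) :
    IntegrableOn (fun ξ : ℝ => ξ ^ s • Φ ξ) (Set.Ioi 0) := by
  have hmeas : AEStronglyMeasurable (fun ξ : ℝ => ξ ^ s • Φ ξ) volume :=
    (by fun_prop : Measurable fun ξ : ℝ => ξ ^ s).aestronglyMeasurable.smul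
      Φ.continuous.aestronglyMeasurable
  rw [← Set.Ioc_union_Ioi_eq_Ioi zero_le_one]
  refine IntegrableOn.union ?_ ?_
  · have h := (intervalIntegrable_iff_integrableOn_Ioc_of_le zero_le_one).1
      (intervalIntegral.intervalIntegrable_rpow' (a := 0) (b := 1) hs)
    obtain ⟨C, hC⟩ := Φ.decay 0 0
    refine (h.norm.mul_const C).mono' hmeas.restrict (.of_forall fun ξ => ?_)
    have := hC.2 ξ
    simp only [pow_zero, one_mul, norm_iteratedFDeriv_zero] at this
    rw [norm_smul]
    gcongr
  · obtain ⟨k, hk⟩ := exists_nat_ge s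
    refine (Φ.integrable_pow_mul volume k).integrableOn.mono' hmeas.restrict ?_
    refine (ae_restrict_iff' measurableSet_Ioi).2 (.of_forall fun ξ hξ => ?_)
    have hξ1 : 1 ≤ ξ := le_of_lt hξ
    rw [norm_smul, Real.norm_of_nonneg (by positivity), Real.norm_of_nonneg (by positivity)]
    gcongr
    rw [← Real.rpow_natCast]
    exact Real.rpow_le_rpow_of_exponent_le hξ1 hk

/-- The substitution `η = ξ ^ m` on the half-line turns the weighted phase `e^{itξᵐ}` into `e^{itη}`
and is, up to a factor `m⁻¹`, an isometry in `L²`. -/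
theorem exists_rpow_substitution {m : ℝ} (hm : 0 < m) {h : ℝ → ℂ} (hmeas : Measurable h)
    (h1 : IntegrableOn (fun ξ : ℝ => ξ ^ ((m - 1) / 2) • h ξ) (Set.Ioi 0))
    (h2 : IntegrableOn (fun ξ : ℝ => ‖h ξ‖ ^ 2) (Set.Ioi 0)) :
    ∃ G : ℝ → ℂ, Integrable G ∧ MemLp G 2 ∧
      (∀ t : ℝ, ∫ η, Complex.exp (Complex.I * ((t * η : ℝ) : ℂ)) * G η =
        ∫ ξ in Set.Ioi (0 : ℝ), Complex.exp (Complex.I * ((t * ξ ^ m : ℝ) : ℂ)) *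
          (ξ ^ ((m - 1) / 2) • h ξ)) ∧
      ∫ η, ‖G η‖ ^ 2 = m⁻¹ * ∫ ξ in Set.Ioi (0 : ℝ), ‖h ξ‖ ^ 2 := by
  let g : ℝ → ℂ := fun η => (m⁻¹ * (η ^ m⁻¹) ^ (-((m - 1) / 2))) • h (η ^ m⁻¹)
  have hgmeas : Measurable g := by
    have : Measurable fun η : ℝ => η ^ m⁻¹ := by fun_prop
    exact (by fun_prop : Measurable fun η : ℝ => m⁻¹ * (η ^ m⁻¹) ^ (-((m - 1) / 2))).smul
      (hmeas.comp this)
  have hroot : ∀ ξ ∈ Set.Ioi (0 : ℝ), (ξ ^ m) ^ m⁻¹ = ξ := fun ξ hξ =>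
    Real.rpow_rpow_inv (le_of_lt hξ) hm.ne'
  have hexp : ∀ ξ ∈ Set.Ioi (0 : ℝ), ξ ^ (m - 1) = ξ ^ ((m - 1) / 2) * ξ ^ ((m - 1) / 2) :=
    fun ξ hξ => by rw [← Real.rpow_add hξ, add_halves]
  have hg1 : ∀ ξ ∈ Set.Ioi (0 : ℝ),
      (m * ξ ^ (m - 1)) • g (ξ ^ m) = ξ ^ ((m - 1) / 2) • h ξ := fun ξ hξ => by
    have hpos : 0 < ξ ^ ((m - 1) / 2) := Real.rpow_pos_of_pos hξ _
    simp only [g]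
    rw [hroot ξ hξ, smul_smul, hexp ξ hξ, Real.rpow_neg (le_of_lt hξ)]
    congr 1
    field_simp
  have hg2 : ∀ ξ ∈ Set.Ioi (0 : ℝ),
      (m * ξ ^ (m - 1)) • ‖g (ξ ^ m)‖ ^ 2 = m⁻¹ * ‖h ξ‖ ^ 2 := fun ξ hξ => by
    have hpos : 0 < ξ ^ ((m - 1) / 2) := Real.rpow_pos_of_pos hξ _
    simp only [g]
    rw [hroot ξ hξ, norm_smul, hexp ξ hξ, Real.rpow_neg (le_of_lt hξ),
      Real.norm_of_nonneg (by positivity), smul_eq_mul]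
    field_simp
  have hint1 : IntegrableOn g (Set.Ioi 0) := by
    rw [← integrableOn_Ioi_comp_rpow_iff g hm.ne', abs_of_pos hm]
    exact h1.congr_fun (fun ξ hξ => (hg1 ξ hξ).symm) measurableSet_Ioi
  have hint2 : IntegrableOn (fun η => ‖g η‖ ^ 2) (Set.Ioi 0) := by
    rw [← integrableOn_Ioi_comp_rpow_iff _ hm.ne', abs_of_pos hm]
    exact IntegrableOn.congr_fun (h2.const_mul m⁻¹) (fun ξ hξ => (hg2 ξ hξ).symm)
      measurableSet_Ioi
  refine ⟨(Set.Ioi 0).indicator g, (integrable_indicator_iff measurableSet_Ioi).2 hint1,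
    (memLp_indicator_iff_restrict measurableSet_Ioi).2
      ((memLp_two_iff_integrable_sq_norm hgmeas.aestronglyMeasurable).2 hint2), fun t => ?_, ?_⟩
  · have : (fun η : ℝ => Complex.exp (Complex.I * ((t * η : ℝ) : ℂ)) * (Set.Ioi 0).indicator g η)
        = (Set.Ioi 0).indicator
          fun η : ℝ => Complex.exp (Complex.I * ((t * η : ℝ) : ℂ)) * g η := by
      ext η; by_cases hη : η ∈ Set.Ioi (0 : ℝ) <;> simp [hη]
    rw [this, integral_indicator measurableSet_Ioi, ← integral_comp_rpow_Ioi_of_pos hm]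
    refine setIntegral_congr_fun measurableSet_Ioi fun ξ hξ => ?_
    rw [← hg1 ξ hξ]
    exact (mul_smul_comm _ _ _).symm
  · have : (fun η : ℝ => ‖(Set.Ioi 0).indicator g η‖ ^ 2)
        = (Set.Ioi 0).indicator fun η : ℝ => ‖g η‖ ^ 2 := by
      ext η; by_cases hη : η ∈ Set.Ioi (0 : ℝ) <;> simp [hη]
    rw [this, integral_indicator measurableSet_Ioi, ← integral_comp_rpow_Ioi_of_pos hm,
      ← integral_const_mul]
    exact setIntegral_congr_fun measurableSet_Ioi hg2

/-- Plancherel's theorem for the angular-frequency inverse Fourier integral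
`t ↦ (2π)⁻¹ ∫ e^{itη} G(η) dη`. -/
theorem eLpNorm_angular_fourierInv {G : ℝ → ℂ} (hG1 : Integrable G) (hG2 : MemLp G 2) :
    eLpNorm (fun t : ℝ => ((2 * Real.pi : ℝ) : ℂ)⁻¹ *
        ∫ η, Complex.exp (Complex.I * ((t * η : ℝ) : ℂ)) * G η) 2 volume
      = ENNReal.ofReal √((2 * Real.pi)⁻¹ * ∫ η, ‖G η‖ ^ 2) := by
  have hc : -(2 * Real.pi)⁻¹ ≠ 0 := neg_ne_zero.2 (by positivity)
  have hT : ∀ t : ℝ, ∫ η, Complex.exp (Complex.I * ((t * η : ℝ) : ℂ)) * G η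
      = 𝓕 G (-(2 * Real.pi)⁻¹ * t) := fun t => by
    rw [Real.fourier_eq']
    refine integral_congr_ae (.of_forall fun y => ?_)
    simp only [smul_eq_mul]
    congr 2
    have : (Real.pi : ℂ) ≠ 0 := by exact_mod_cast Real.pi_ne_zero
    simp
    field_simp
  have hF := memLp_fourierIntegral hG1 hG2
  have hcont : Continuous (𝓕 G) :=
    VectorFourier.fourierIntegral_continuous Real.continuous_fourierChar
      (innerSL ℝ).continuous₂ hG1
  have hmem : MemLp (fun t : ℝ => 𝓕 G (-(2 * Real.pi)⁻¹ * t)) 2 := by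
    rw [memLp_two_iff_integrable_sq_norm (by fun_prop)]
    exact Integrable.comp_mul_left'
      ((memLp_two_iff_integrable_sq_norm hcont.aestronglyMeasurable).1 hF) hc
  simp only [hT]
  rw [eLpNorm_two_eq_sqrt_integral (hmem.const_mul _)]
  simp only [norm_mul, mul_pow]
  rw [integral_const_mul, Measure.integral_comp_mul_left (fun ξ => ‖𝓕 G ξ‖ ^ 2),
    integral_norm_sq_fourierIntegral hG1 hG2, smul_eq_mul, ← mul_assoc]
  congr 3
  rw [norm_inv, Complex.norm_real, Real.norm_of_nonneg (by positivity), inv_neg, inv_inv,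
    abs_neg, abs_of_pos (by positivity)]
  field_simp

/-- For `m > 0` and `φ` Schwartz with `φ̂` supported in `[0,∞)`,
`√m ‖|D|^{(m−1)/2} e^{it|D|^m} φ(x)‖_{L²(ℝ_t)} = ‖φ(x+·)‖_{L²} = ‖φ‖_{L²}` at each `x`. -/
theorem stmt17 (m : ℝ) (hm : 0 < m) (φ : SchwartzMap ℝ ℂ)
    (φhat : ℝ → ℂ)
    (hhat : φhat = fun ξ : ℝ => ∫ y : ℝ, Complex.exp (-Complex.I * ((ξ * y : ℝ) : ℂ)) * φ y)
    (hsupp : Function.support φhat ⊆ Set.Ici (0 : ℝ)) (x : ℝ) :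
    ENNReal.ofReal (Real.sqrt m) * eLpNorm (fun t : ℝ =>
        ((2 * Real.pi : ℝ) : ℂ)⁻¹ * ∫ ξ in Set.Ioi (0 : ℝ),
          Complex.exp (Complex.I * ((x * ξ + t * ξ ^ m : ℝ) : ℂ)) *
            ((ξ ^ ((m - 1) / 2) : ℝ) : ℂ) * φhat ξ)
      2 (volume : Measure ℝ)
      = eLpNorm (fun t : ℝ => φ (x + t)) 2 (volume : Measure ℝ) ∧
    eLpNorm (fun t : ℝ => φ (x + t)) 2 (volume : Measure ℝ)
      = eLpNorm (fun y : ℝ => φ y) 2 (volume : Measure ℝ) := by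
  have hshift : eLpNorm (fun t : ℝ => φ (x + t)) 2 (volume : Measure ℝ)
      = eLpNorm (fun y : ℝ => φ y) 2 (volume : Measure ℝ) :=
    eLpNorm_comp_measurePreserving (f := fun t => x + t) φ.continuous.aestronglyMeasurable
      (measurePreserving_add_left volume x)
  refine ⟨?_, hshift⟩
  obtain ⟨Φ, hΦ, hΦ2⟩ := exists_schwartzMap_angular_fourier φ
  obtain rfl : φhat = Φ := hhat.trans (funext fun ξ => (hΦ ξ).symm)
  let h : ℝ → ℂ := fun ξ => Complex.exp (Complex.I * ((x * ξ : ℝ) : ℂ)) * Φ ξ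
  have hcont : Continuous h := by
    have := Φ.continuous
    fun_prop
  have hnorm : ∀ ξ, ‖h ξ‖ = ‖Φ ξ‖ := fun ξ => by
    simp only [h]
    rw [norm_mul, mul_comm Complex.I, Complex.norm_exp_ofReal_mul_I, one_mul]
  have h1 : IntegrableOn (fun ξ : ℝ => ξ ^ ((m - 1) / 2) • h ξ) (Set.Ioi 0) := by
    refine Integrable.mono (Φ.integrableOn_rpow_smul (s := (m - 1) / 2) (by linarith)) ?_
      (.of_forall fun ξ => by rw [norm_smul, norm_smul, hnorm])
    exact (by fun_prop : Measurable fun ξ : ℝ => ξ ^ ((m - 1) / 2)).aestronglyMeasurable.smul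
      hcont.aestronglyMeasurable
  have h2 : IntegrableOn (fun ξ : ℝ => ‖h ξ‖ ^ 2) (Set.Ioi 0) := by
    simp only [hnorm]
    exact ((memLp_two_iff_integrable_sq_norm Φ.continuous.aestronglyMeasurable).1
      (Φ.memLp 2)).integrableOn
  have hhalf : ∫ ξ in Set.Ioi (0 : ℝ), ‖h ξ‖ ^ 2 = ∫ ξ, ‖Φ ξ‖ ^ 2 := by
    simp only [hnorm]
    rw [← integral_Ici_eq_integral_Ioi]
    refine setIntegral_eq_integral_of_forall_compl_eq_zero fun ξ hξ => ?_
    rw [Function.notMem_support.1 fun hmem => hξ (hsupp hmem)]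
    simp
  obtain ⟨G, hG1, hG2, hGt, hGn⟩ := exists_rpow_substitution hm hcont.measurable h1 h2
  have hphase : ∀ t : ℝ, ∫ ξ in Set.Ioi (0 : ℝ),
      Complex.exp (Complex.I * ((x * ξ + t * ξ ^ m : ℝ) : ℂ)) *
        ((ξ ^ ((m - 1) / 2) : ℝ) : ℂ) * Φ ξ
      = ∫ η, Complex.exp (Complex.I * ((t * η : ℝ) : ℂ)) * G η := fun t => by
    rw [hGt]
    refine integral_congr_ae (.of_forall fun ξ => ?_)
    simp only [h, Complex.real_smul]
    rw [Complex.ofReal_add, mul_add, Complex.exp_add]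
    ring
  simp only [hphase]
  rw [hshift, eLpNorm_angular_fourierInv hG1 hG2, eLpNorm_two_eq_sqrt_integral (φ.memLp 2),
    ← ENNReal.ofReal_mul (by positivity), ← Real.sqrt_mul hm.le, hGn, hhalf, hΦ2]
  congr 2
  field_simp
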